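/- arXiv:2102.10424 — 3 statements merged into one kernel-verified Lean document; each statement's English description precedes it below -/
import Mathlib

section
/- Property (bounded norm of aggregated features): Let A ∈ {0,1}^{n×n} be the adjacency matrix of a simple undirected graph, D the diagonal degree matrix with D_ii = Σ_j A_ij, and Ā = I + D^{−1/2} A D^{−1/2}. Suppose there exist ε ∈ (0,1) and a positive integer p such that (1−ε)² p ≤ D_ii ≤ (1+ε)² p for all i ∈ [n], and suppose x_1, …, x_n ∈ ℝ^d satisfy ‖x_i‖₂ ≤ (1−ε)/2 for all i. Then the aggregated features x̂_i = Σ_{i'=1}^n Ā_{i i'} x_{i'} satisfy ‖x̂_i‖₂ ≤ 1 for all i ∈ [n]. -/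
open Finset Matrix

/-- Property (bounded norm of aggregated features): for a simple undirected graph with
adjacency matrix `A`, degrees `D_ii` satisfying `(1−ε)²p ≤ D_ii ≤ (1+ε)²p`, and
`Ā = I + D^{-1/2} A D^{-1/2}`, if `‖x_i‖₂ ≤ (1−ε)/2` for all `i`, then the aggregated
features `x̂_i = ∑_{i'} Ā_{i i'} x_{i'}` satisfy `‖x̂_i‖₂ ≤ 1`. -/
theorem aggregated_features_norm_le_one
    (n d : ℕ) (A : Matrix (Fin n) (Fin n) ℝ)
    (hsym : A.IsSymm) (h01 : ∀ i j, A i j = 0 ∨ A i j = 1) (hdiag : ∀ i, A i i = 0)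
    (deg : Fin n → ℝ) (hdeg : ∀ i, deg i = ∑ j, A i j)
    (ε : ℝ) (hε : 0 < ε) (hε1 : ε < 1) (p : ℕ) (hp : 0 < p)
    (hdegLB : ∀ i, (1 - ε) ^ 2 * (p : ℝ) ≤ deg i)
    (hdegUB : ∀ i, deg i ≤ (1 + ε) ^ 2 * (p : ℝ))
    (x : Fin n → EuclideanSpace ℝ (Fin d))
    (hx : ∀ i, ‖x i‖ ≤ (1 - ε) / 2)
    (Abar : Matrix (Fin n) (Fin n) ℝ)
    (hAbar : Abar = 1 + Matrix.of fun i j =>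
      A i j / (Real.sqrt (deg i) * Real.sqrt (deg j)))
    (xhat : Fin n → EuclideanSpace ℝ (Fin d))
    (hxhat : ∀ i, xhat i = ∑ i', Abar i i' • x i') :
    ∀ i, ‖xhat i‖ ≤ 1 := by
  intro i
  have hpR : (0 : ℝ) < p := by exact_mod_cast hp
  have he : 0 < 1 - ε := by linarith
  obtain ⟨s, hs⟩ : ∃ s, s = Real.sqrt (p : ℝ) := ⟨_, rfl⟩
  have hs0 : 0 < s := by rw [hs]; exact Real.sqrt_pos.mpr hpR
  have hss : s ^ 2 = p := by rw [hs]; exact Real.sq_sqrt hpR.le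
  have hlow : ∀ j, (1 - ε) * s ≤ Real.sqrt (deg j) := fun j => by
    apply Real.le_sqrt_of_sq_le
    rw [mul_pow, hss]; exact hdegLB j
  have hup : Real.sqrt (deg i) ≤ (1 + ε) * s := by
    apply Real.sqrt_le_iff.mpr
    refine ⟨by positivity, ?_⟩
    rw [mul_pow, hss]; exact hdegUB i
  have hes : 0 < (1 - ε) * s := mul_pos he hs0
  have hr : 0 < Real.sqrt (deg i) := lt_of_lt_of_le hes (hlow i)
  have hrr : Real.sqrt (deg i) * Real.sqrt (deg i) = deg i :=
    Real.mul_self_sqrt (Real.sqrt_pos.mp hr).le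
  have hA0 : ∀ j, 0 ≤ A i j := fun j => by rcases h01 i j with h | h <;> simp [h]
  have hexp : xhat i = x i
      + ∑ j, (A i j / (Real.sqrt (deg i) * Real.sqrt (deg j))) • x j := by
    rw [hxhat, hAbar]
    simp [Matrix.add_apply, add_smul, Finset.sum_add_distrib, Matrix.one_apply]
  have hterm : ∀ j, ‖(A i j / (Real.sqrt (deg i) * Real.sqrt (deg j))) • x j‖
      ≤ A i j * (1 / (Real.sqrt (deg i) * ((1 - ε) * s)) * ((1 - ε) / 2)) := fun j => by
    have h1 : 0 ≤ A i j / (Real.sqrt (deg i) * Real.sqrt (deg j)) :=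
      div_nonneg (hA0 j) (by positivity)
    rw [norm_smul, Real.norm_of_nonneg h1, ← mul_assoc, mul_one_div]
    apply mul_le_mul _ (hx j) (norm_nonneg _)
    · exact div_nonneg (hA0 j) (by positivity)
    · apply div_le_div_of_nonneg_left (hA0 j) (by positivity)
      exact mul_le_mul_of_nonneg_left (hlow j) hr.le
  have hsum : ‖∑ j, (A i j / (Real.sqrt (deg i) * Real.sqrt (deg j))) • x j‖
      ≤ (1 + ε) / 2 := by
    refine (norm_sum_le _ _).trans ((Finset.sum_le_sum fun j _ => hterm j).trans ?_)
    rw [← Finset.sum_mul, ← hdeg]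
    have h2 : deg i * (1 / (Real.sqrt (deg i) * ((1 - ε) * s)) * ((1 - ε) / 2))
        = Real.sqrt (deg i) / (2 * s) := by
      nth_rewrite 1 [← hrr]
      field_simp
    rw [h2, div_le_iff₀ (by positivity)]
    linarith
  rw [hexp]
  have := norm_add_le (x i) (∑ j, (A i j / (Real.sqrt (deg i) * Real.sqrt (deg j))) • x j)
  have := hx i
  linarith
end

section
/- Cumulative weight drift during local training: Under the setting where ‖x̂_{i'}‖₂ ≤ 1 for all i', a_r ∈ {−1,1}, M^{(j)}_r ∈ {0,1}, and Ā is symmetric with nonnegative entries and spectral norm ‖Ā‖₂, consider the local gradient descent iterates θ^{(j)}_{t,k+1,r} = θ^{(j)}_{t,k,r} − η ∂L(Θ^{(j)}_{t,k})/∂θ_r starting from θ^{(j)}_{t,0,r}, with the explicit gradient formula ∂L(Θ)/∂θ_r = (1/√d₁) Σ_i Σ_{i'} (ŷ^{(j)}_i(Θ) − y_i) Ā_{i i'} M^{(j)}_r a_r x̂_{i'} 𝟙{⟨θ_r, x̂_{i'}⟩ ≥ 0}. Then for every r and every k, ‖θ^{(j)}_{t,k,r} − θ^{(j)}_{t,0,r}‖₂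 ≤ η ‖Ā‖₂ √(n/d₁) Σ_{k'=0}^{k−1} ‖y − ŷ^{(j)}(t,k')‖₂, where ŷ^{(j)}(t,k') denotes the sub-GCN output at local iterate Θ^{(j)}_{t,k'}. -/
open Finset Matrix RealInnerProductSpace

theorem gcn_step_bound (n d : ℕ) (A : Matrix (Fin n) (Fin n) ℝ) (hsym : A.IsSymm)
    (x : Fin n → EuclideanSpace ℝ (Fin d)) (hx : ∀ i', ‖x i'‖ ≤ 1)
    (e : EuclideanSpace ℝ (Fin n)) (c : Fin n → ℝ) (hc : ∀ i, |c i| ≤ 1) :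
    ‖∑ i, ∑ i', (e i * A i i' * c i') • x i'‖
      ≤ Real.sqrt n * (‖Matrix.toEuclideanCLM (𝕜 := ℝ) A‖ * ‖e‖) := by
  set v := Matrix.toEuclideanCLM (𝕜 := ℝ) A e with hv
  have hvi : ∀ i', v i' = ∑ i, e i * A i i' := by
    intro i'
    have h1 : v i' = (A *ᵥ e.ofLp) i' := by
      rw [hv]; simp
    rw [h1]
    simp only [Matrix.mulVec, dotProduct]
    refine Finset.sum_congr rfl fun i _ => ?_
    rw [hsym.apply i i', mul_comm]
  have h2 : ∑ i, ∑ i', (e i * A i i' * c i') • x i' = ∑ i', (v i' * c i') • x i' := by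
    rw [Finset.sum_comm]
    refine Finset.sum_congr rfl fun i' _ => ?_
    rw [← Finset.sum_smul, hvi, Finset.sum_mul]
  rw [h2]
  have h3 : ‖∑ i', (v i' * c i') • x i'‖ ≤ ∑ i', |v i'| := by
    refine (norm_sum_le _ _).trans (Finset.sum_le_sum fun i _ => ?_)
    rw [norm_smul, Real.norm_eq_abs, abs_mul, mul_assoc]
    exact mul_le_of_le_one_right (abs_nonneg _)
      (mul_le_one₀ (hc i) (norm_nonneg _) (hx i))
  have h4 : ∑ i', |v i'| ≤ Real.sqrt n * ‖v‖ := by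
    rw [EuclideanSpace.norm_eq, ← Real.sqrt_mul (Nat.cast_nonneg n)]
    apply Real.le_sqrt_of_sq_le
    have := sq_sum_le_card_mul_sum_sq (s := Finset.univ) (f := fun i => |v i|)
    simpa using this
  exact h3.trans (h4.trans (mul_le_mul_of_nonneg_left
    (ContinuousLinearMap.le_opNorm _ _) (Real.sqrt_nonneg _)))

/-- Cumulative weight drift during local training: along the local gradient descent
iterates `θ_{k+1,r} = θ_{k,r} − η ∂L(Θ_k)/∂θ_r` of a sub-GCN, for every `r` and `k`,
`‖θ_{k,r} − θ_{0,r}‖₂ ≤ η ‖Ā‖₂ √(n/d₁) ∑_{k'=0}^{k−1} ‖y − ŷ(k')‖₂`. -/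
theorem subGCN_local_weight_drift
    (n d d₁ : ℕ) (hd₁ : 0 < d₁)
    (Abar : Matrix (Fin n) (Fin n) ℝ)
    (hsym : Abar.IsSymm) (hnonneg : ∀ i j, 0 ≤ Abar i j)
    (xhat : Fin n → EuclideanSpace ℝ (Fin d)) (hxhat : ∀ i', ‖xhat i'‖ ≤ 1)
    (a : Fin d₁ → ℝ) (ha : ∀ r, a r = 1 ∨ a r = -1)
    (M : Fin d₁ → ℝ) (hM : ∀ r, M r = 0 ∨ M r = 1)
    (y : EuclideanSpace ℝ (Fin n))
    (η : ℝ) (hη : 0 < η)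
    (θ : ℕ → Fin d₁ → EuclideanSpace ℝ (Fin d))
    (yhat : ℕ → EuclideanSpace ℝ (Fin n))
    (hyhat : ∀ k i, yhat k i =
      (1 / Real.sqrt d₁) *
        ∑ i', ∑ r, Abar i i' * M r * a r * max ⟪xhat i', θ k r⟫ 0)
    (hstep : ∀ k r, θ (k + 1) r = θ k r -
      η • ((1 / Real.sqrt d₁) •
        ∑ i, ∑ i',
          ((yhat k i - y i) * Abar i i' * M r * a r *
            (if 0 ≤ ⟪θ k r, xhat i'⟫ then (1 : ℝ) else 0)) • xhat i')) :
    ∀ k r, ‖θ k r - θ 0 r‖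
      ≤ η * ‖Matrix.toEuclideanCLM (𝕜 := ℝ) Abar‖ * Real.sqrt ((n : ℝ) / d₁) *
          ∑ k' ∈ Finset.range k, ‖y - yhat k'‖ := by
  intro k r
  have step : ∀ k, ‖θ (k + 1) r - θ k r‖ ≤
      η * ‖Matrix.toEuclideanCLM (𝕜 := ℝ) Abar‖ * Real.sqrt ((n : ℝ) / d₁) * ‖y - yhat k‖ := by
    intro k
    have hb := gcn_step_bound n d Abar hsym xhat hxhat (yhat k - y)
      (fun i' => M r * a r * (if 0 ≤ ⟪θ k r, xhat i'⟫ then (1 : ℝ) else 0)) (by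
        intro i
        rcases hM r with h | h <;> rcases ha r with h' | h' <;> simp only [h, h'] <;>
          split_ifs <;> norm_num)
    simp only [PiLp.sub_apply, ← mul_assoc] at hb
    rw [hstep k r, sub_sub_cancel_left, norm_neg, norm_smul, norm_smul,
      Real.norm_of_nonneg hη.le, Real.norm_of_nonneg (by positivity),
      Real.sqrt_div (Nat.cast_nonneg n), norm_sub_rev y]
    calc _ ≤ η * (1 / Real.sqrt d₁ * (Real.sqrt n *
          ‖Matrix.toEuclideanCLM (𝕜 := ℝ) Abar‖ * ‖yhat k - y‖)) := by gcongr
      _ = _ := by ring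
  induction k with
  | zero => simp
  | succ k ih =>
    rw [Finset.sum_range_succ, mul_add, ← sub_add_sub_cancel (θ (k + 1) r) (θ k r) (θ 0 r)]
    refine (norm_add_le _ _).trans ?_
    linarith [step k]
end

section
/- Lemma (bound on initial error): Let θ_{0,1}, …, θ_{0,d₁} be independent random vectors in ℝ^d with independent standard Gaussian coordinates, and a_1, …, a_{d₁} independent uniform {−1,1} random variables, independent of the θ's. Suppose ‖x̂_{i'}‖₂ ≤ 1 for all i' ∈ [n], Ā ∈ ℝ^{n×n} has nonnegative entries, and the labels satisfy |y_i| ≤ C for all i. Then the initial output ŷ(0) with coordinates ŷ_i(0) = (1/(m√d₁)) Σ_{i'} Σ_r Ā_{i i'} a_r σ(⟨x̂_{i'}, θ_{0,r}⟩) satisfies E[‖y − ŷ(0)‖₂²] ≤ C² n + (d/m²) ‖Ā²‖_{1,1}, where ‖Ā²‖_{1,1} = Σ_{i,j}(Ā²)_{ij}. -/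
open Finset MeasureTheory ProbabilityTheory

lemma sign_avg (k : ℕ) : ∀ (g : Fin k → ℝ) (y : ℝ),
    ∑ s : Fin k → Bool, (y - ∑ r, (if s r then (1 : ℝ) else -1) * g r) ^ 2
      = 2 ^ k * (y ^ 2 + ∑ r, g r ^ 2) := by
  induction k with
  | zero => intro g y; simp
  | succ k ih =>
    intro g y
    rw [← (Fin.consEquiv (fun _ : Fin (k + 1) => Bool)).sum_comp, Fintype.sum_prod_type]
    have h : ∀ b : Bool, ∑ s : Fin k → Bool, (y - ∑ r, (if (Fin.consEquiv
        (fun _ : Fin (k + 1) => Bool)) (b, s) r then (1 : ℝ) else -1) * g r) ^ 2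
        = 2 ^ k * ((y - (if b then (1 : ℝ) else -1) * g 0) ^ 2 + ∑ r : Fin k, g r.succ ^ 2) := by
      intro b
      rw [← ih]
      refine Finset.sum_congr rfl fun s _ => ?_
      rw [Fin.sum_univ_succ]
      simp only [Fin.consEquiv_apply, Fin.cons_zero, Fin.cons_succ]
      ring
    rw [Finset.sum_congr rfl fun b _ => h b, Fintype.sum_bool, Fin.sum_univ_succ]
    simp only [if_true, Bool.false_eq_true, if_false]
    ring

lemma gauss_sq : Integrable (fun x : ℝ => x ^ 2) (gaussianReal 0 1) ∧
    ∫ x, x ^ 2 ∂(gaussianReal 0 1) = 1 := by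
  constructor
  · exact (memLp_id_gaussianReal 2).integrable_sq
  · have h := variance_id_gaussianReal (μ := 0) (v := 1)
    rw [variance_eq_integral aemeasurable_id] at h
    simpa using h

lemma gauss_coord (k d : ℕ) (r : Fin k) (l : Fin d) :
    Integrable (fun T : Fin k → Fin d → ℝ => (T r l) ^ 2)
      (Measure.pi fun _ : Fin k => Measure.pi fun _ : Fin d => gaussianReal 0 1) ∧
    ∫ T : Fin k → Fin d → ℝ, (T r l) ^ 2
      ∂(Measure.pi fun _ : Fin k => Measure.pi fun _ : Fin d => gaussianReal 0 1) = 1 := by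
  have h1 := measurePreserving_eval (fun _ : Fin k => Measure.pi fun _ : Fin d => gaussianReal 0 1) r
  have h2 := measurePreserving_eval (fun _ : Fin d => gaussianReal 0 1) l
  have h := h2.comp h1
  constructor
  · exact h.integrable_comp_of_integrable gauss_sq.1
  · have h3 := gauss_sq.2
    rw [← h.map_eq, integral_map h.measurable.aemeasurable
      (by fun_prop)] at h3
    exact h3

/-- Lemma (bound on initial error): with `θ_{0,r}` i.i.d. `N(0, I_d)` and `a_r` i.i.d.
uniform `{−1,1}` independent of the `θ`'s, if `‖x̂_{i'}‖₂ ≤ 1`, `Ā` is symmetric with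
nonnegative entries, and `|y_i| ≤ C`, then the initial output
`ŷ_i(0) = (1/(m√d₁)) ∑_{i'} ∑_r Ā_{i i'} a_r σ(⟨x̂_{i'}, θ_{0,r}⟩)` satisfies
`E[‖y − ŷ(0)‖₂²] ≤ C² n + (d/m²) ‖Ā²‖_{1,1}` with `‖Ā²‖_{1,1} = ∑_{i,j} (Ā²)_{ij}`.
(The expectation over the signs is written as the uniform average over all sign
assignments.) -/
theorem initial_error_bound
    (n d d₁ m : ℕ) (hd₁ : 0 < d₁) (hm : 0 < m)
    (Abar : Matrix (Fin n) (Fin n) ℝ)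
    (hsym : Abar.IsSymm) (hnonneg : ∀ i j, 0 ≤ Abar i j)
    (xhat : Fin n → Fin d → ℝ) (hxhat : ∀ i', ∑ l, (xhat i' l) ^ 2 ≤ 1)
    (C : ℝ) (y : Fin n → ℝ) (hy : ∀ i, |y i| ≤ C) :
    (∫ Θ : Fin d₁ → Fin d → ℝ,
        (Fintype.card (Fin d₁ → Bool) : ℝ)⁻¹ *
          ∑ s : Fin d₁ → Bool,
            ∑ i, (y i -
              (1 / ((m : ℝ) * Real.sqrt d₁)) *
                ∑ i', ∑ r, Abar i i' * (if s r then (1 : ℝ) else -1) *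
                  max (∑ l, xhat i' l * Θ r l) 0) ^ 2
        ∂(Measure.pi fun _ : Fin d₁ => Measure.pi fun _ : Fin d => gaussianReal 0 1))
      ≤ C ^ 2 * n + ((d : ℝ) / (m : ℝ) ^ 2) * ∑ i, ∑ j, (Abar * Abar) i j := by
  set c : ℝ := 1 / ((m : ℝ) * Real.sqrt d₁) with hc
  have hd : (0 : ℝ) < d₁ := by exact_mod_cast hd₁
  have hm' : (0 : ℝ) < m := by exact_mod_cast hm
  have hc2 : c ^ 2 = 1 / ((m : ℝ) ^ 2 * d₁) := by
    rw [hc, div_pow, mul_pow, Real.sq_sqrt hd.le, one_pow]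
  set S : ℝ := ∑ i, ∑ j, (Abar * Abar) i j with hS
  have hSrow : ∑ i, (∑ j, Abar i j) ^ 2 = S := by
    have h1 : ∀ i j, Abar i j = Abar j i := fun i j => hsym.apply j i
    simp only [hS, Matrix.mul_apply]
    have h2 : ∀ k, (∑ j, Abar k j) ^ 2 = ∑ i, ∑ j, Abar i k * Abar k j := by
      intro k
      rw [sq, Finset.sum_mul_sum]
      exact Finset.sum_congr rfl fun i _ => Finset.sum_congr rfl fun j _ => by rw [h1 k i]
    rw [Finset.sum_congr rfl fun k _ => h2 k, Finset.sum_comm]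
    exact Finset.sum_congr rfl fun i _ => Finset.sum_comm
  have key : ∀ T : Fin d₁ → Fin d → ℝ,
      (Fintype.card (Fin d₁ → Bool) : ℝ)⁻¹ *
          ∑ s : Fin d₁ → Bool, ∑ i, (y i - c *
                ∑ i', ∑ r, Abar i i' * (if s r then (1 : ℝ) else -1) *
                  max (∑ l, xhat i' l * T r l) 0) ^ 2
      ≤ C ^ 2 * n + c ^ 2 * S * ∑ r, ∑ l, (T r l) ^ 2 := by
    intro T
    have e1 : ∀ i, ∑ s : Fin d₁ → Bool, (y i - c *
                ∑ i', ∑ r, Abar i i' * (if s r then (1 : ℝ) else -1) *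
                  max (∑ l, xhat i' l * T r l) 0) ^ 2
        = 2 ^ d₁ * ((y i) ^ 2 + ∑ r, (c * ∑ i', Abar i i' *
            max (∑ l, xhat i' l * T r l) 0) ^ 2) := by
      intro i
      rw [← sign_avg]
      refine Finset.sum_congr rfl fun s _ => ?_
      rw [Finset.sum_comm, Finset.mul_sum]
      congr 2
      refine Finset.sum_congr rfl fun r _ => ?_
      rw [Finset.mul_sum, Finset.mul_sum, Finset.mul_sum]
      exact Finset.sum_congr rfl fun j _ => by ring
    have hcard : (Fintype.card (Fin d₁ → Bool) : ℝ) = 2 ^ d₁ := by simp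
    rw [Finset.sum_comm, Finset.sum_congr rfl fun i _ => e1 i, ← Finset.mul_sum, hcard,
      inv_mul_cancel_left₀ (by positivity), Finset.sum_add_distrib]
    have b1 : ∑ i, (y i) ^ 2 ≤ C ^ 2 * n := by
      calc ∑ i, (y i) ^ 2 ≤ ∑ _i : Fin n, C ^ 2 := Finset.sum_le_sum fun i _ =>
            sq_le_sq.mpr ((hy i).trans (le_abs_self C))
        _ = C ^ 2 * n := by simp [mul_comm]
    have b2 : ∀ i r, (c * ∑ i', Abar i i' * max (∑ l, xhat i' l * T r l) 0) ^ 2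
        ≤ c ^ 2 * ((∑ j, Abar i j) ^ 2 * ∑ l, (T r l) ^ 2) := by
      intro i r
      have hN : 0 ≤ ∑ l, (T r l) ^ 2 := Finset.sum_nonneg fun l _ => sq_nonneg _
      rw [mul_pow]
      refine mul_le_mul_of_nonneg_left ?_ (sq_nonneg c)
      rw [← Real.sq_sqrt hN, ← mul_pow]
      refine pow_le_pow_left₀ (Finset.sum_nonneg fun j _ =>
        mul_nonneg (hnonneg i j) (le_max_right _ _)) ?_ 2
      rw [Finset.sum_mul]
      refine Finset.sum_le_sum fun j _ => mul_le_mul_of_nonneg_left ?_ (hnonneg i j)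
      refine max_le (Real.le_sqrt_of_sq_le ?_) (Real.sqrt_nonneg _)
      calc (∑ l, xhat j l * T r l) ^ 2 ≤ (∑ l, xhat j l ^ 2) * ∑ l, T r l ^ 2 :=
            Finset.sum_mul_sq_le_sq_mul_sq _ _ _
        _ ≤ _ := mul_le_of_le_one_left hN (hxhat j)
    refine add_le_add b1 ?_
    calc _ ≤ ∑ i, ∑ r, c ^ 2 * ((∑ j, Abar i j) ^ 2 * ∑ l, (T r l) ^ 2) :=
          Finset.sum_le_sum fun i _ => Finset.sum_le_sum fun r _ => b2 i r
      _ = c ^ 2 * S * ∑ r, ∑ l, (T r l) ^ 2 := by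
          rw [← hSrow]
          simp only [← Finset.mul_sum]
          rw [← Finset.sum_mul, mul_assoc]
  have hint : Integrable (fun T : Fin d₁ → Fin d → ℝ => ∑ r, ∑ l, (T r l) ^ 2)
      (Measure.pi fun _ : Fin d₁ => Measure.pi fun _ : Fin d => gaussianReal 0 1) :=
    integrable_finsetSum _ fun r _ => integrable_finsetSum _ fun l _ =>
      (gauss_coord d₁ d r l).1
  have hval : ∫ T : Fin d₁ → Fin d → ℝ, ∑ r, ∑ l, (T r l) ^ 2
      ∂(Measure.pi fun _ : Fin d₁ => Measure.pi fun _ : Fin d => gaussianReal 0 1)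
      = d₁ * d := by
    rw [integral_finsetSum _ fun r _ => integrable_finsetSum _ fun l _ =>
      (gauss_coord d₁ d r l).1]
    rw [Finset.sum_congr rfl fun r _ => integral_finsetSum _ fun l _ =>
      (gauss_coord d₁ d r l).1]
    simp only [(gauss_coord d₁ d _ _).2]
    simp
  refine (integral_mono_of_nonneg (Filter.Eventually.of_forall fun T => ?_)
    ((integrable_const (C ^ 2 * (n : ℝ))).add (hint.const_mul (c ^ 2 * S)))
    (Filter.Eventually.of_forall key)).trans ?_
  · exact mul_nonneg (by positivity) (Finset.sum_nonneg fun s _ =>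
      Finset.sum_nonneg fun i _ => sq_nonneg _)
  · simp only [Pi.add_apply]
    rw [integral_add (integrable_const _) (hint.const_mul _), integral_const_mul (c ^ 2 * S), hval, hc2]
    simp only [integral_const, probReal_univ, smul_eq_mul, one_mul]
    apply le_of_eq
    field_simp
end
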